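/- (Successor-rule content of the theorem for subtrees of the 'first 1' cycle-joining tree T2.) Let N be a set of binary necklaces of length n such that 0^n ∈ N and, for every α ∈ N with α ≠ 0^n, the word obtained from α by flipping its first 1 (the 1 of smallest index) to 0 belongs to N. Let S = S_N. For a_1a_2⋯a_n ∈ S, if the word contains a 1 let j be the largest index with a_j = 1 and let γ = 0^{n−j} 1 a_2⋯a_j (a word of length n); if a_1⋯a_n = 0^n let γ = 0^{n−1}1. Define f(a_1⋯a_n) to be the complement of a_1 if γ is a necklace and a_2⋯a_n ā_1 ∈ S, and a_1 otherwise. Then the map g(a_1a_2⋯a_n) = a_2⋯a_n f(a_1a_2⋯a_n) maps S into S and acts as a single cycle on S: for all σ, τ ∈ S there exists m ≥ 0 with g^{(m)}(σ) = τ. Equivalently, f is the successor rule of a universal cycle for S. -/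

import Mathlib

/-- A necklace: a word that is lexicographically less than or equal to
every one of its rotations.  (Over `Bool`, the order is `false < true`.) -/
def IsNecklace {A : Type*} [LinearOrder A] (α : List A) : Prop :=
  ∀ i : ℕ, ¬ List.Lex (· < ·) (α.rotate i) α

/-- The rotation class of `α`: the set of all rotations of `α`. -/
def rotClass {A : Type*} [DecidableEq A] (α : List A) : Finset (List A) :=
  ((List.range α.length).map α.rotate).toFinset

/-- `S_N`: the set of all rotations of all members of `N`. -/
def SN (N : Finset (List Bool)) : Finset (List Bool) :=
  N.biUnion rotClass

open scoped Classical in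
/-- The shift map `g(a₁a₂⋯aₙ) = a₂⋯aₙ f(a₁a₂⋯aₙ)` for the successor rule `f` of the
'first 1' tree: letting `j` be the largest (1-based) index with `a_j = 1` and
`γ = 0^{n-j} 1 a₂⋯a_j` (with `γ = 0^{n-1}1` when the word is all `0`s), we have
`f = ā₁` if `γ` is a necklace and `a₂⋯aₙā₁ ∈ S`, and `f = a₁` otherwise. -/
noncomputable def gFirstOne (S : Finset (List Bool)) (w : List Bool) : List Bool :=
  let r := (w.reverse.takeWhile (fun b => !b)).length
  let γ := if r = w.length then List.replicate (w.length - 1) false ++ [true]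
           else List.replicate r false ++ true :: (w.take (w.length - r)).drop 1
  let b := if IsNecklace γ ∧ w.drop 1 ++ [!w.headI] ∈ S then !w.headI else w.headI
  w.drop 1 ++ [b]

/-- `Reaches f x y`: some iterate of `f` sends `x` to `y`. -/
def Reaches {A : Type*} (f : A → A) (x y : A) : Prop := ∃ m : ℕ, f^[m] x = y

theorem Reaches.refl {A : Type*} (f : A → A) (x : A) : Reaches f x x := ⟨0, rfl⟩

theorem Reaches.step {A : Type*} (f : A → A) (x : A) : Reaches f x (f x) := ⟨1, rfl⟩

theorem Reaches.trans {A : Type*} {f : A → A} {x y z : A}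
    (hxy : Reaches f x y) (hyz : Reaches f y z) : Reaches f x z := by
  obtain ⟨a, rfl⟩ := hxy
  obtain ⟨b, rfl⟩ := hyz
  exact ⟨b + a, Function.iterate_add_apply f b a x⟩

/-- Reachability inside a finite set that `f` permutes is symmetric. -/
theorem Reaches.symm {A : Type*} {f : A → A} {S : Finset A}
    (hmaps : ∀ x ∈ S, f x ∈ S) (hinj : ∀ x ∈ S, ∀ y ∈ S, f x = f y → x = y)
    {x y : A} (hx : x ∈ S) (hxy : Reaches f x y) : Reaches f y x := by
  obtain ⟨m, rfl⟩ := hxy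
  let F : S → S := fun z => ⟨f z, hmaps z z.2⟩
  have hF : Function.Injective F := fun a b hab =>
    Subtype.ext (hinj a a.2 b b.2 (congrArg Subtype.val hab))
  have hval : ∀ k (z : S), ((F^[k] z : S) : A) = f^[k] z := by
    intro k
    induction k with
    | zero => intro z; rfl
    | succ k ih => intro z; rw [Function.iterate_succ_apply, Function.iterate_succ_apply, ih]
  obtain ⟨p, hp, hper⟩ := hF.mem_periodicPts ⟨x, hx⟩
  have hper' : f^[p * m] x = x := by
    have h := congrArg Subtype.val (hper.mul_const m).eq
    rwa [hval] at h
  refine ⟨p * m - m, ?_⟩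
  rw [← Function.iterate_add_apply, Nat.sub_add_cancel (Nat.le_mul_of_pos_left m hp), hper']

theorem mem_rotClass {A : Type*} [DecidableEq A] {α w : List A} (hα : 0 < α.length) :
    w ∈ rotClass α ↔ α ~r w := by
  simp only [rotClass, List.mem_toFinset, List.mem_map, List.mem_range]
  constructor
  · rintro ⟨i, -, rfl⟩
    exact ⟨i, rfl⟩
  · rintro ⟨i, rfl⟩
    exact ⟨i % α.length, Nat.mod_lt _ hα, List.rotate_mod α i⟩

theorem IsNecklace.eq_of_isRotated {A : Type*} [LinearOrder A] {α β : List A}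
    (hα : IsNecklace α) (hβ : IsNecklace β) (h : α ~r β) : α = β := by
  obtain ⟨i, hi⟩ := h
  obtain ⟨j, hj⟩ := List.IsRotated.symm ⟨i, hi⟩
  have h1 : ¬ β < α := by have := hα i; rwa [hi] at this
  have h2 : ¬ α < β := by have := hβ j; rwa [hj] at this
  exact le_antisymm (not_lt.mp h1) (not_lt.mp h2)

/-- The number of trailing zeros of a word. -/
def trailingZeros (y : List Bool) : ℕ := (y.reverse.takeWhile (fun b => !b)).length

theorem trailingZeros_append_replicate {u : List Bool} (i : ℕ)
    (hu : u = [] ∨ ∃ v, u = v ++ [true]) :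
    trailingZeros (u ++ List.replicate i false) = i := by
  rcases hu with rfl | ⟨v, rfl⟩ <;> simp [trailingZeros]

theorem exists_eq_append_replicate (y : List Bool) :
    ∃ (u : List Bool) (i : ℕ), y = u ++ List.replicate i false ∧
      (u = [] ∨ ∃ v, u = v ++ [true]) := by
  induction y using List.reverseRecOn with
  | nil => exact ⟨[], 0, rfl, Or.inl rfl⟩
  | append_singleton l a ih =>
    cases a with
    | true => exact ⟨l ++ [true], 0, by simp, Or.inr ⟨l, rfl⟩⟩
    | false =>
      obtain ⟨u, i, rfl, hu⟩ := ih
      exact ⟨u, i + 1, by simp [List.replicate_succ'], hu⟩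

/-- The word `γ`, as a function of the word `y` that remains after deleting the first letter:
if `y = u 0^i` with `u` empty or ending in `1`, then `firstOneWord y = 0^i 1 u`. -/
def firstOneWord (y : List Bool) : List Bool :=
  List.replicate (trailingZeros y) false ++ true :: y.take (y.length - trailingZeros y)

theorem firstOneWord_append_replicate {u : List Bool} (i : ℕ)
    (hu : u = [] ∨ ∃ v, u = v ++ [true]) :
    firstOneWord (u ++ List.replicate i false) = List.replicate i false ++ true :: u := by
  simp [firstOneWord, trailingZeros_append_replicate i hu]

theorem isRotated_firstOneWord (y : List Bool) : (true :: y) ~r firstOneWord y := by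
  obtain ⟨u, i, rfl, hu⟩ := exists_eq_append_replicate y
  rw [firstOneWord_append_replicate i hu]
  exact List.isRotated_append (l := true :: u)

theorem replicate_append_cons_inj {i k : ℕ} {u v : List Bool}
    (h : List.replicate i false ++ true :: u = List.replicate k false ++ true :: v) :
    i = k ∧ u = v := by
  induction i generalizing k with
  | zero => cases k <;> simp_all [List.replicate_succ]
  | succ i ih =>
    cases k with
    | zero => simp [List.replicate_succ] at h
    | succ k =>
      simp only [List.replicate_succ, List.cons_append, List.cons.injEq, true_and] at h
      simpa using ih h

theorem firstOneWord_injective : Function.Injective firstOneWord := by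
  intro y z h
  obtain ⟨u, i, rfl, hu⟩ := exists_eq_append_replicate y
  obtain ⟨v, k, rfl, hv⟩ := exists_eq_append_replicate z
  rw [firstOneWord_append_replicate i hu, firstOneWord_append_replicate k hv] at h
  obtain ⟨rfl, rfl⟩ := replicate_append_cons_inj h
  rfl

theorem exists_eq_replicate_append_true {α : List Bool}
    (h : α ≠ List.replicate α.length false) :
    ∃ i u, α = List.replicate i false ++ true :: u := by
  induction α with
  | nil => simp at h
  | cons a l ih =>
    cases a with
    | true => exact ⟨0, l, rfl⟩
    | false =>
      obtain ⟨i, u, hl⟩ := ih (by simpa [List.replicate_succ] using h)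
      exact ⟨i + 1, u, by rw [hl]; simp [List.replicate_succ]⟩

/-- A necklace other than `0^n` ends in `1`. -/
theorem IsNecklace.eq_nil_or_append_true {i : ℕ} {u : List Bool}
    (h : IsNecklace (List.replicate i false ++ true :: u)) :
    u = [] ∨ ∃ v, u = v ++ [true] := by
  rcases List.eq_nil_or_concat u with rfl | ⟨v, b, rfl⟩
  · exact Or.inl rfl
  · cases b with
    | true => exact Or.inr ⟨v, by simp⟩
    | false =>
      exfalso
      have hrot : (List.replicate i false ++ true :: (v ++ [false])) ~r
          (List.replicate i false ++ false :: true :: v) := by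
        have h1 := List.isRotated_append (l := List.replicate i false ++ true :: v) (l' := [false])
        have h2 : [false] ++ (List.replicate i false ++ true :: v)
            = List.replicate i false ++ false :: true :: v := by
          rw [← List.append_assoc, List.singleton_append, ← List.replicate_succ,
            List.replicate_succ', List.append_assoc, List.singleton_append]
        rw [h2] at h1
        simpa using h1
      obtain ⟨k, hk⟩ := hrot
      simp only [List.concat_eq_append] at h
      refine h k ?_
      rw [hk]
      exact List.Lex.append_left _ (List.Lex.rel (by decide)) _

open scoped Classical in
theorem gFirstOne_cons (S : Finset (List Bool)) (a : Bool) (y : List Bool) :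
    gFirstOne S (a :: y) =
      y ++ [if IsNecklace (firstOneWord y) ∧ y ++ [!a] ∈ S then !a else a] := by
  obtain ⟨u, i, rfl, hu⟩ := exists_eq_append_replicate y
  have hγ := firstOneWord_append_replicate i hu
  have key : (if (((a :: (u ++ List.replicate i false)).reverse.takeWhile
        (fun b => !b)).length = (a :: (u ++ List.replicate i false)).length) then
        List.replicate ((a :: (u ++ List.replicate i false)).length - 1) false ++ [true]
      else List.replicate ((a :: (u ++ List.replicate i false)).reverse.takeWhile
          (fun b => !b)).length false ++
        true :: ((a :: (u ++ List.replicate i false)).take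
          ((a :: (u ++ List.replicate i false)).length -
            ((a :: (u ++ List.replicate i false)).reverse.takeWhile
              (fun b => !b)).length)).drop 1) = List.replicate i false ++ true :: u := by
    rcases hu with rfl | ⟨v, rfl⟩
    · cases a <;> simp
    · have h1 : v.length + (i + 1) + 1 - i = v.length + 1 + 1 := by omega
      have h2 : i ≠ v.length + (i + 1) + 1 := by omega
      simp [h1, h2, List.take_append]
  simp only [gFirstOne]
  rw [key, hγ]
  simp

theorem gFirstOne_of_flip {S : Finset (List Bool)} {a : Bool} {y : List Bool}
    (h1 : IsNecklace (firstOneWord y)) (h2 : y ++ [!a] ∈ S) :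
    gFirstOne S (a :: y) = y ++ [!a] := by
  rw [gFirstOne_cons, if_pos ⟨h1, h2⟩]

theorem gFirstOne_of_not_flip {S : Finset (List Bool)} {a : Bool} {y : List Bool}
    (h : ¬ (IsNecklace (firstOneWord y) ∧ y ++ [!a] ∈ S)) :
    gFirstOne S (a :: y) = y ++ [a] := by
  rw [gFirstOne_cons, if_neg h]

theorem isRotated_cons_append_singleton {A : Type*} (a : A) (y : List A) :
    (a :: y) ~r (y ++ [a]) := ⟨1, by simp⟩

section RotationClosed

variable {n : ℕ} {S : Finset (List Bool)}

theorem gFirstOne_mem (hn : 1 ≤ n) (hlen : ∀ w ∈ S, w.length = n)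
    (hrot : ∀ w ∈ S, ∀ v, w ~r v → v ∈ S) {w : List Bool} (hw : w ∈ S) :
    gFirstOne S w ∈ S := by
  cases w with
  | nil => have := hlen _ hw; simp at this; omega
  | cons a y =>
    by_cases h : IsNecklace (firstOneWord y) ∧ y ++ [!a] ∈ S
    · rw [gFirstOne_of_flip h.1 h.2]; exact h.2
    · rw [gFirstOne_of_not_flip h]
      exact hrot _ hw _ (isRotated_cons_append_singleton a y)

theorem gFirstOne_injOn (hn : 1 ≤ n) (hlen : ∀ w ∈ S, w.length = n)
    (hrot : ∀ w ∈ S, ∀ v, w ~r v → v ∈ S) {w : List Bool} (hw : w ∈ S) {v : List Bool}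
    (hv : v ∈ S) (h : gFirstOne S w = gFirstOne S v) : w = v := by
  cases w with
  | nil => have := hlen _ hw; simp at this; omega
  | cons a y =>
    cases v with
    | nil => have := hlen _ hv; simp at this; omega
    | cons b z =>
      have hy := hrot _ hw _ (isRotated_cons_append_singleton a y)
      have hz := hrot _ hv _ (isRotated_cons_append_singleton b z)
      rw [gFirstOne_cons, gFirstOne_cons] at h
      obtain ⟨rfl, h⟩ := List.append_inj' h rfl
      by_cases hγ : IsNecklace (firstOneWord y) <;> cases a <;> cases b <;> simp_all

/-- If `0y` and `1y` lie in `S` and `γ` is a necklace, then `0y` reaches `1y`. -/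
theorem reaches_of_flip (hn : 1 ≤ n) (hlen : ∀ w ∈ S, w.length = n)
    (hrot : ∀ w ∈ S, ∀ v, w ~r v → v ∈ S) {y : List Bool}
    (hneck : IsNecklace (firstOneWord y)) (h1 : true :: y ∈ S) :
    Reaches (gFirstOne S) (false :: y) (true :: y) := by
  obtain ⟨d, hd⟩ : ∃ d, n ≤ y.count true + d := ⟨n, by omega⟩
  induction d generalizing y with
  | zero =>
    have hy := hlen _ h1
    have := List.count_le_length (a := true) (l := y)
    simp at hy
    omega
  | succ d ih =>
    have hstep : ∀ w, (true :: y) ~r w → w ≠ true :: y →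
        Reaches (gFirstOne S) w (w.rotate 1) := by
      intro w hw hne
      have hwS := hrot _ h1 _ hw
      cases w with
      | nil => have := hlen _ hwS; simp at this; omega
      | cons a z =>
        have hrotz : (a :: z).rotate 1 = z ++ [a] := by simp
        rw [hrotz]
        by_cases h : IsNecklace (firstOneWord z) ∧ z ++ [!a] ∈ S
        · cases a with
          | true =>
            have hγ := h.1.eq_of_isRotated hneck
              ((isRotated_firstOneWord z).symm.trans
                (hw.symm.trans (isRotated_firstOneWord y)))
            exact absurd (by rw [firstOneWord_injective hγ]) hne
          | false =>
            have hc := hw.perm.count_eq true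
            simp at hc
            have h1z : true :: z ∈ S :=
              hrot _ h.2 _ (isRotated_cons_append_singleton true z).symm
            have h0z : z ++ [false] ∈ S :=
              hrot _ hwS _ (isRotated_cons_append_singleton false z)
            refine (ih h.1 h1z (by omega)).trans ?_
            have := Reaches.step (gFirstOne S) (true :: z)
            rwa [gFirstOne_of_flip h.1 h0z] at this
        · have := Reaches.step (gFirstOne S) (a :: z)
          rwa [gFirstOne_of_not_flip h] at this
    have hy1 := isRotated_cons_append_singleton true y
    have hiter : ∀ i, Reaches (gFirstOne S) (y ++ [true]) (true :: y) ∨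
        Reaches (gFirstOne S) (y ++ [true]) ((y ++ [true]).rotate i) := by
      intro i
      induction i with
      | zero => right; simpa using Reaches.refl (gFirstOne S) (y ++ [true])
      | succ i ihi =>
        rcases ihi with hi | hi
        · exact Or.inl hi
        · by_cases he : (y ++ [true]).rotate i = true :: y
          · left; rwa [he] at hi
          · right
            have := hi.trans (hstep _ (hy1.trans ⟨i, rfl⟩) he)
            rwa [List.rotate_rotate] at this
    have hfirst := Reaches.step (gFirstOne S) (false :: y)
    rw [gFirstOne_of_flip hneck (by simpa using hrot _ h1 _ hy1)] at hfirst
    refine hfirst.trans ?_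
    rcases hiter y.length with h | h
    · exact h
    · simpa using h

/-- Every word of `S` reaches all its rotations. -/
theorem reaches_of_isRotated (hn : 1 ≤ n) (hlen : ∀ w ∈ S, w.length = n)
    (hrot : ∀ w ∈ S, ∀ v, w ~r v → v ∈ S) {w v : List Bool} (hw : w ∈ S) (hwv : w ~r v) :
    Reaches (gFirstOne S) w v := by
  have hstep : ∀ w ∈ S, Reaches (gFirstOne S) w (w.rotate 1) := by
    intro w hw
    cases w with
    | nil => have := hlen _ hw; simp at this; omega
    | cons a y =>
      have hrota : (a :: y).rotate 1 = y ++ [a] := by simp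
      rw [hrota]
      have ha : y ++ [!!a] ∈ S := by
        rw [Bool.not_not]; exact hrot _ hw _ (isRotated_cons_append_singleton a y)
      by_cases h : IsNecklace (firstOneWord y) ∧ y ++ [!a] ∈ S
      · have ha' := hrot _ h.2 _ (isRotated_cons_append_singleton (!a) y).symm
        have hlast := Reaches.step (gFirstOne S) ((!a) :: y)
        rw [gFirstOne_of_flip h.1 ha, Bool.not_not] at hlast
        refine Reaches.trans ?_ hlast
        cases a with
        | false => exact reaches_of_flip hn hlen hrot h.1 ha'
        | true =>
          exact Reaches.symm (fun x hx => gFirstOne_mem hn hlen hrot hx)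
            (fun x hx z hz => gFirstOne_injOn hn hlen hrot hx hz) ha'
            (reaches_of_flip hn hlen hrot h.1 hw)
      · have := Reaches.step (gFirstOne S) (a :: y)
        rwa [gFirstOne_of_not_flip h] at this
  obtain ⟨i, rfl⟩ := hwv
  induction i with
  | zero => simpa using Reaches.refl (gFirstOne S) w
  | succ i ih =>
    have := ih.trans (hstep _ (hrot _ hw _ ⟨i, rfl⟩))
    rwa [List.rotate_rotate] at this

end RotationClosed

theorem stmt9 {n : ℕ} (hn : 1 ≤ n)
    (N : Finset (List Bool))
    (hNneck : ∀ α ∈ N, α.length = n ∧ IsNecklace α)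
    (hroot : List.replicate n false ∈ N)
    (hclosed : ∀ α ∈ N, α ≠ List.replicate n false → ∀ j, j < n →
      α[j]? = some true → (∀ i, i < j → α[i]? = some false) →
      α.set j false ∈ N) :
    (∀ w ∈ SN N, gFirstOne (SN N) w ∈ SN N) ∧
    ∀ σ ∈ SN N, ∀ τ ∈ SN N, ∃ m : ℕ, (gFirstOne (SN N))^[m] σ = τ := by
  have hmem : ∀ w, w ∈ SN N ↔ ∃ α ∈ N, α ~r w := by
    intro w
    rw [SN, Finset.mem_biUnion]
    exact exists_congr fun α => and_congr_right fun hα =>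
      mem_rotClass (by rw [(hNneck α hα).1]; exact hn)
  have hlen : ∀ w ∈ SN N, w.length = n := by
    intro w hw
    obtain ⟨α, hα, hαw⟩ := (hmem w).1 hw
    rw [← hαw.perm.length_eq, (hNneck α hα).1]
  have hrot : ∀ w ∈ SN N, ∀ v, w ~r v → v ∈ SN N := by
    intro w hw v hwv
    obtain ⟨α, hα, hαw⟩ := (hmem w).1 hw
    exact (hmem v).2 ⟨α, hα, hαw.trans hwv⟩
  have hzero : List.replicate n false ∈ SN N := (hmem _).2 ⟨_, hroot, List.IsRotated.refl _⟩
  have hmaps : ∀ w ∈ SN N, gFirstOne (SN N) w ∈ SN N :=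
    fun w hw => gFirstOne_mem hn hlen hrot hw
  have hsymm : ∀ x ∈ SN N, ∀ y, Reaches (gFirstOne (SN N)) x y →
      Reaches (gFirstOne (SN N)) y x := fun x hx y hxy =>
    hxy.symm hmaps (fun x hx z hz => gFirstOne_injOn hn hlen hrot hx hz) hx
  have hto : ∀ k, ∀ w ∈ SN N, w.count true = k →
      Reaches (gFirstOne (SN N)) w (List.replicate n false) := by
    intro k
    induction k with
    | zero =>
      intro w hw hk
      have : w = List.replicate n false := by
        rw [List.eq_replicate_iff]
        refine ⟨hlen w hw, fun b hb => ?_⟩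
        rw [List.count_eq_zero] at hk
        cases b
        · rfl
        · exact absurd hb hk
      rw [this]
      exact Reaches.refl _ _
    | succ k ih =>
      intro w hw hk
      obtain ⟨α, hα, hαw⟩ := (hmem w).1 hw
      obtain ⟨hαn, hαneck⟩ := hNneck α hα
      have hcount : α.count true = k + 1 := by rw [hαw.perm.count_eq, hk]
      have hne : α ≠ List.replicate n false := by
        rintro rfl
        simp [List.count_replicate] at hcount
      obtain ⟨i, u, rfl⟩ := exists_eq_replicate_append_true (by rwa [hαn])
      have hγ := firstOneWord_append_replicate i hαneck.eq_nil_or_append_true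
      have hpar := hclosed _ hα hne i (by simp at hαn; omega) (by simp) (by
        intro j hj
        simp [List.getElem?_append, hj])
      have hset : (List.replicate i false ++ true :: u).set i false
          = List.replicate i false ++ false :: u := by
        simp
      rw [hset] at hpar
      have h0 : false :: (u ++ List.replicate i false) ∈ SN N :=
        (hmem _).2 ⟨_, hpar, List.isRotated_append (l' := false :: u)⟩
      have hα1 : (List.replicate i false ++ true :: u) ~r
          (true :: (u ++ List.replicate i false)) := List.isRotated_append (l' := true :: u)
      have h1 : true :: (u ++ List.replicate i false) ∈ SN N := (hmem _).2 ⟨_, hα, hα1⟩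
      refine (reaches_of_isRotated hn hlen hrot hw (hαw.symm.trans hα1)).trans
        (Reaches.trans (hsymm _ h0 _ ?_) (ih _ h0 ?_))
      · exact reaches_of_flip hn hlen hrot (by rwa [hγ]) h1
      · simpa [List.count_replicate] using hcount
  exact ⟨hmaps, fun σ hσ τ hτ =>
    (hto _ σ hσ rfl).trans (hsymm τ hτ _ (hto _ τ hτ rfl))⟩
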